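/- Let u : E → M_m be twice continuously differentiable with u(x) invertible for every x and with x ↦ (u x)⁻¹ twice continuously differentiable, and let α : E → (E →L[ℝ] M_m) be a continuously differentiable matrix-valued 1-form. Set A := A_u + α, where A_u(x)v := (u x) * (fderiv ℝ (fun y => (u y)⁻¹) x v). Then the curvature of A is F_A(x)(v,w) = (fderiv ℝ α x v) w − (fderiv ℝ α x w) v + [A_u(x)v, α(x)w] − [A_u(x)w, α(x)v] + (α x v)*(α x w) − (α x w)*(α x v), where [a,b] := a*b − b*a; i.e. F = dA_phys + [A_pure, A_phys] + A_phys². -/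

import Mathlib

attribute [local instance] Matrix.linftyOpNormedRing Matrix.linftyOpNormedAlgebra
attribute [-instance] instTopologicalSpaceMatrix Matrix.instUniformSpace

theorem curv_aux {E R : Type*} [NormedAddCommGroup E] [NormedSpace ℝ E]
    [NormedRing R] [NormedAlgebra ℝ R]
    (u g : E → R) (hu : ContDiff ℝ 2 u) (hg : ContDiff ℝ 2 g)
    (hug : ∀ x, u x * g x = 1) (hgu : ∀ x, g x * u x = 1)
    (α A : E → (E →L[ℝ] R)) (hα : ContDiff ℝ 1 α)
    (hA : ∀ x v, A x v = u x * (fderiv ℝ g x v) + α x v) (x v w : E) :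
      (fderiv ℝ A x v) w - (fderiv ℝ A x w) v + (A x v) * (A x w) - (A x w) * (A x v)
        = (fderiv ℝ α x v) w - (fderiv ℝ α x w) v
          + ((u x * (fderiv ℝ g x v)) * (α x w) - (α x w) * (u x * (fderiv ℝ g x v)))
          - ((u x * (fderiv ℝ g x w)) * (α x v) - (α x v) * (u x * (fderiv ℝ g x w)))
          + (α x v) * (α x w) - (α x w) * (α x v) := by
  have hud : HasFDerivAt u (fderiv ℝ u x) x :=
    (hu.differentiable (by norm_num) x).hasFDerivAt
  have hgd : HasFDerivAt g (fderiv ℝ g x) x :=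
    (hg.differentiable (by norm_num) x).hasFDerivAt
  have hαd : HasFDerivAt α (fderiv ℝ α x) x :=
    (hα.differentiable (by norm_num) x).hasFDerivAt
  have hg1 : ContDiff ℝ 1 (fderiv ℝ g) := hg.fderiv_right (by norm_num)
  have hgdd : HasFDerivAt (fderiv ℝ g) (fderiv ℝ (fderiv ℝ g) x) x :=
    (hg1.differentiable (by norm_num) x).hasFDerivAt
  have hAe : A = fun y => ((ContinuousLinearMap.mul ℝ R) (u y)).comp (fderiv ℝ g y) + α y := by
    funext y
    ext z
    simp [hA]
  have hAd := ((((ContinuousLinearMap.mul ℝ R).hasFDerivAt.comp x hud).clm_comp hgdd).add hαd)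
  have key : ∀ a b, fderiv ℝ A x a b
      = u x * (fderiv ℝ (fderiv ℝ g) x a b) + fderiv ℝ u x a * fderiv ℝ g x b
        + fderiv ℝ α x a b := by
    intro a b
    have hAe' : A = (fun y => (ContinuousLinearMap.mul ℝ R ∘ u) y ∘SL fderiv ℝ g y) + α := hAe
    rw [hAe', hAd.fderiv]
    simp
  have hsymm : fderiv ℝ (fderiv ℝ g) x v w = fderiv ℝ (fderiv ℝ g) x w v :=
    (hg.contDiffAt.isSymmSndFDerivAt (by simp)) v w
  have hdu : ∀ a, fderiv ℝ u x a = - (u x * fderiv ℝ g x a * u x) := by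
    intro a
    have h1 := hud.mul' hgd
    have h2 : HasFDerivAt (u * g) (0 : E →L[ℝ] R) x := by
      have : u * g = fun _ => (1 : R) := funext hug
      rw [this]
      exact hasFDerivAt_const _ _
    have h3 := congrArg (fun L => L a) (h1.unique h2)
    simp at h3
    have h4 : fderiv ℝ u x a * g x = - (u x * fderiv ℝ g x a) :=
      eq_neg_of_add_eq_zero_right h3
    calc fderiv ℝ u x a = fderiv ℝ u x a * g x * u x := by rw [mul_assoc, hgu, mul_one]
      _ = _ := by rw [h4, neg_mul]
  rw [key, key, hdu, hdu, hsymm, hA, hA]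
  noncomm_ring

/-- Let `u : E → M_m` be `C²` with pointwise invertible values and
`C²` pointwise inverse, and `α` a `C¹` matrix-valued 1-form.  With
`A := A_u + α`, where `A_u x v := u x * (fderiv ℝ (fun y => (u y)⁻¹) x v)`, the
curvature of `A` is `F = dA_phys + [A_pure, A_phys] + A_phys²`. -/
theorem curvature_of_split_potential
    {E : Type*} [NormedAddCommGroup E] [NormedSpace ℝ E]
    {m : ℕ} (hm : 0 < m)
    (u : E → Matrix (Fin m) (Fin m) ℝ)
    (hu : ContDiff ℝ 2 u)
    (hunit : ∀ x, IsUnit (u x))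
    (huinv : ContDiff ℝ 2 (fun y => (u y)⁻¹))
    (α : E → (E →L[ℝ] Matrix (Fin m) (Fin m) ℝ))
    (hα : ContDiff ℝ 1 α)
    (A : E → (E →L[ℝ] Matrix (Fin m) (Fin m) ℝ))
    (hA : ∀ x v, A x v = u x * (fderiv ℝ (fun y => (u y)⁻¹) x v) + α x v) :
    ∀ (x v w : E),
      (fderiv ℝ A x v) w - (fderiv ℝ A x w) v + (A x v) * (A x w) - (A x w) * (A x v)
        = (fderiv ℝ α x v) w - (fderiv ℝ α x w) v
          + ((u x * (fderiv ℝ (fun y => (u y)⁻¹) x v)) * (α x w)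
              - (α x w) * (u x * (fderiv ℝ (fun y => (u y)⁻¹) x v)))
          - ((u x * (fderiv ℝ (fun y => (u y)⁻¹) x w)) * (α x v)
              - (α x v) * (u x * (fderiv ℝ (fun y => (u y)⁻¹) x w)))
          + (α x v) * (α x w) - (α x w) * (α x v) := by
  have hdet : ∀ x, IsUnit (u x).det := fun x => (Matrix.isUnit_iff_isUnit_det _).1 (hunit x)
  exact curv_aux u (fun y => (u y)⁻¹) hu huinv (fun x => Matrix.mul_nonsing_inv _ (hdet x))
    (fun x => Matrix.nonsing_inv_mul _ (hdet x)) α A hα hA
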